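/- Skein relation, product form (Theorem, first equation): let 1 ≤ j < i_1 < i_2 < … < i_r ≤ n, I = {i_1,…,i_r}, and 1 ≤ k ≤ r. Let (G_+, G_−, G_0, G_∞) be a skein quadruple of Gauss diagrams on n strings at a crossing between strings j and i_k. Then Z_{I,j}(G_+) − Z_{I,j}(G_−) = Z_{I_k^-, j}(G_∞) · Z_{I_k^+, i_k}(G_0), where I_k^- = {i_1,…,i_{k−1}} and I_k^+ = {i_{k+1},…,i_r}. -/

import Mathlib

/-!
Combinatorial Gauss diagrams on `n` strings and the tree invariants `Z I j`.

A Gauss diagram is encoded by a finite set of arrows; each arrow records the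
string (an element of `Fin n`) and the position (a rational number, increasing
in the direction of the orientation of the string) of its tail and of its head,
together with a sign `±1`.  Only the induced combinatorial data (linear order of
the endpoints along each string, the tail/head pairing and the signs) is ever
used by the definitions below.

The tree invariant `Z I j G = ∑_{A ∈ 𝒜_{I,j}} sign(A) ⟨A, G⟩` is computed as a
signed count over all subsets `S` of the arrows of `G` that form a planar tree
diagram with leaves on `I` and trunk on `j`: each pair `(A, φ)` of a planar tree
diagram `A ∈ 𝒜_{I,j}` together with an embedding `φ : A → G` corresponds
bijectively to the subset `S = Im φ` of the arrows of `G`, which is itself a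
planar tree diagram with leaves on `I` and trunk on `j`; the contribution of the
pair to the sum is `sign(A) · sign(φ) = (-1)^{#right-pointing arrows of S} · ∏_{a ∈ S} sign(a)`.
-/

open scoped Classical

/-- An arrow of a Gauss diagram on `n` strings: a tail endpoint, a head
endpoint (each given by the string it lies on and its position along that
string) and a sign. -/
structure GArrow (n : ℕ) where
  tailStr : Fin n
  tailPos : ℚ
  headStr : Fin n
  headPos : ℚ
  sign : ℤ
deriving DecidableEq

namespace GArrow

/-- The two endpoints of an arrow: `false` is the tail, `true` is the head. -/
def ep {n : ℕ} (a : GArrow n) : Bool → Fin n × ℚ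
  | false => (a.tailStr, a.tailPos)
  | true => (a.headStr, a.headPos)

end GArrow

/-- A Gauss diagram on `n` strings: a finite set of signed arrows with all
endpoints pairwise distinct, and all signs equal to `±1`. -/
structure GaussDiagram (n : ℕ) where
  arrows : Finset (GArrow n)
  sign_pm : ∀ a ∈ arrows, a.sign = 1 ∨ a.sign = -1
  endpoints_distinct : ∀ a ∈ arrows, ∀ b ∈ arrows, ∀ s t : Bool,
    a.ep s = b.ep t → a = b ∧ s = t

/-- `S` is a tree diagram with leaves on `I` and trunk on `j`:
* the head and the tail of every arrow lie on different strings;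
* for each `i ∈ I` there is exactly one arrow tail on string `i`, and there are
  no arrow tails on strings outside `I`;
* every arrow head lies on a string of `I ∪ {j}`;
* on each string `i ∈ I` all arrow heads precede the unique arrow tail. -/
def IsTreeDiagram {n : ℕ} (I : Finset (Fin n)) (j : Fin n)
    (S : Finset (GArrow n)) : Prop :=
  (∀ a ∈ S, a.tailStr ≠ a.headStr) ∧
  (∀ i ∈ I, ∃! a, a ∈ S ∧ a.tailStr = i) ∧
  (∀ a ∈ S, a.tailStr ∈ I) ∧
  (∀ a ∈ S, a.headStr ∈ I ∨ a.headStr = j) ∧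
  (∀ a ∈ S, ∀ b ∈ S, a.headStr = b.tailStr → a.headPos < b.tailPos)

/-- `ParentRel S s t` : string `s` is the parent of string `t` in the rooted
tree determined by the tree diagram `S`, i.e. the (unique) arrow with tail on
`t` has its head on `s`. -/
def ParentRel {n : ℕ} (S : Finset (GArrow n)) (s t : Fin n) : Prop :=
  ∃ a ∈ S, a.tailStr = t ∧ a.headStr = s

/-- `Descends S s k` : string `k` belongs to the subtree of string `s` (it is
`s` itself or an iterated child of `s`). -/
def Descends {n : ℕ} (S : Finset (GArrow n)) : Fin n → Fin n → Prop :=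
  Relation.ReflTransGen (ParentRel S)

/-- `S` is a *planar* tree diagram with leaves on `I` and trunk on `j`: the
rooted tree `T_S` determined by `S` can be drawn in the plane so that the
clockwise order of its leaves, starting from the root on string `j`, is the
order of the string numbers.  Combinatorially this says that:
* the parent relation makes the strings carrying the arrows into a tree rooted
  at `j` (every leaf string is an iterated child of `j`);
* the whole subtree hanging from an arrow lies on the same side of the string
  carrying the head of that arrow as its tail does;
* two subtrees hanging on the same side of a common string are ordered, along
  that string, compatibly with the order of the strings: for two arrow heads on
  the same string, with both tails on the left, the subtree attached closer to
  the beginning of the string is the one carrying the larger string numbers,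
  while for two tails on the right it is the one carrying the smaller string
  numbers. -/
def IsPlanarTreeDiagram {n : ℕ} (I : Finset (Fin n)) (j : Fin n)
    (S : Finset (GArrow n)) : Prop :=
  IsTreeDiagram I j S ∧
  (∀ i ∈ I, Relation.TransGen (ParentRel S) j i) ∧
  (∀ a ∈ S, ∀ k : Fin n, Descends S a.tailStr k →
    (a.tailStr < a.headStr ↔ k < a.headStr)) ∧
  (∀ a ∈ S, ∀ b ∈ S, a.headStr = b.headStr → a.headPos < b.headPos →
    ∀ k k' : Fin n, Descends S a.tailStr k → Descends S b.tailStr k' →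
      ((a.tailStr < a.headStr → b.tailStr < b.headStr → k' < k) ∧
       (a.headStr < a.tailStr → b.headStr < b.tailStr → k < k')))

/-- The sign `(-1)^q` of an (embedded) arrow diagram, where `q` is the number
of right-pointing arrows (tail on a string of smaller number than the head). -/
noncomputable def treeSign {n : ℕ} (S : Finset (GArrow n)) : ℤ :=
  (-1) ^ (S.filter fun a => a.tailStr < a.headStr).card

/-- The tree invariant `Z_{I,j}(G) = ∑_{A ∈ 𝒜_{I,j}} sign(A)·⟨A,G⟩`, computed
as the signed count of embedded planar tree diagrams with leaves on `I` and
trunk on `j` inside `G`.  In particular `Z ∅ j G = 1` (only `S = ∅`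
contributes). -/
noncomputable def Z {n : ℕ} (I : Finset (Fin n)) (j : Fin n)
    (G : GaussDiagram n) : ℤ :=
  ∑ S ∈ G.arrows.powerset,
    if IsPlanarTreeDiagram I j S then treeSign S * ∏ a ∈ S, a.sign else 0

/-- Reversing the orientation of string `i`: the linear order of the endpoints
on string `i` is reversed (positions are negated) and the sign of every arrow
with exactly one endpoint on string `i` is multiplied by `-1`. -/
def reverseArrow {n : ℕ} (i : Fin n) (a : GArrow n) : GArrow n where
  tailStr := a.tailStr
  tailPos := if a.tailStr = i then -a.tailPos else a.tailPos
  headStr := a.headStr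
  headPos := if a.headStr = i then -a.headPos else a.headPos
  sign := if (a.tailStr = i ∧ a.headStr ≠ i) ∨ (a.tailStr ≠ i ∧ a.headStr = i)
    then -a.sign else a.sign

/-- The position of the endpoint of the arrow `a` lying on string `s` (for an
arrow joining `s` to a different string). -/
def posOn {n : ℕ} (a : GArrow n) (s : Fin n) : ℚ :=
  if a.tailStr = s then a.tailPos else a.headPos

/-- The oriented smoothing at a crossing of strings `j` and `i` located at
position `pj` on string `j` and position `pi` on string `i`: the final portions
of the two strings are exchanged, i.e. an endpoint on string `j` after `pj`
moves to string `i` (after `pi`, in the same order) and vice versa. -/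
def smoothEp {n : ℕ} (j i : Fin n) (pj pi : ℚ) (e : Fin n × ℚ) : Fin n × ℚ :=
  if e.1 = j ∧ pj < e.2 then (i, pi + (e.2 - pj))
  else if e.1 = i ∧ pi < e.2 then (j, pj + (e.2 - pi))
  else e

/-- The effect of the oriented smoothing on an arrow. -/
def smoothArrow {n : ℕ} (j i : Fin n) (pj pi : ℚ) (a : GArrow n) : GArrow n where
  tailStr := (smoothEp j i pj pi (a.tailStr, a.tailPos)).1
  tailPos := (smoothEp j i pj pi (a.tailStr, a.tailPos)).2
  headStr := (smoothEp j i pj pi (a.headStr, a.headPos)).1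
  headPos := (smoothEp j i pj pi (a.headStr, a.headPos)).2
  sign := a.sign

/-- `(Gp, Gm, G0, Ginf)` is a skein quadruple at a crossing between strings `j`
and `i`:
* `Gp` has a distinguished arrow `a` of sign `+1` joining strings `j` and `i`
  (in either direction);
* `Gm` is obtained from `Gp` by switching the crossing (exchanging the tail and
  the head of `a` and changing its sign to `-1`);
* `G0` is obtained by deleting `a` and exchanging the final portions of strings
  `j` and `i` at the positions of `a` (the oriented smoothing);
* `Ginf` is obtained by first reversing the orientation of string `i` and then
  smoothing at `a` respecting the new orientations. -/
def IsSkeinQuadruple {n : ℕ} (j i : Fin n) (Gp Gm G0 Ginf : GaussDiagram n) :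
    Prop :=
  j ≠ i ∧
  ∃ a ∈ Gp.arrows, a.sign = 1 ∧
    ((a.tailStr = j ∧ a.headStr = i) ∨ (a.tailStr = i ∧ a.headStr = j)) ∧
    Gm.arrows =
      insert (GArrow.mk a.headStr a.headPos a.tailStr a.tailPos (-1))
        (Gp.arrows.erase a) ∧
    G0.arrows =
      (Gp.arrows.erase a).image (smoothArrow j i (posOn a j) (posOn a i)) ∧
    Ginf.arrows =
      ((Gp.arrows.image (reverseArrow i)).erase (reverseArrow i a)).image
        (smoothArrow j i (posOn a j) (-(posOn a i)))

section Smoothing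

variable {n : ℕ}

theorem smoothEp_involutive {j i : Fin n} (hij : j ≠ i) (pj pi : ℚ) :
    Function.Involutive (smoothEp j i pj pi) := by
  rintro ⟨s, p⟩
  unfold smoothEp
  have := hij.symm
  split_ifs <;> grind

theorem smoothArrow_injective {j i : Fin n} (hij : j ≠ i) (pj pi : ℚ) :
    Function.Injective (smoothArrow j i pj pi) := by
  rintro ⟨ts, tp, hs, hp, s⟩ ⟨ts', tp', hs', hp', s'⟩ h
  simp only [smoothArrow, GArrow.mk.injEq] at h
  obtain ⟨h1, h2, h3, h4, h5⟩ := h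
  have ht := (smoothEp_involutive hij pj pi).injective (Prod.ext h1 h2)
  have hh := (smoothEp_involutive hij pj pi).injective (Prod.ext h3 h4)
  simp_all

theorem reverseArrow_injective (i : Fin n) : Function.Injective (reverseArrow i) := by
  rintro ⟨ts, tp, hs, hp, s⟩ ⟨ts', tp', hs', hp', s'⟩ h
  simp only [reverseArrow, GArrow.mk.injEq] at h
  obtain ⟨rfl, h2, rfl, h4, h5⟩ := h
  simp only [GArrow.mk.injEq, true_and]
  refine ⟨?_, ?_, ?_⟩
  · split_ifs at h2 <;> simpa using h2
  · split_ifs at h4 <;> simpa using h4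
  · split_ifs at h5 <;> simpa using h5

/-- The effect on arrows of reversing string `i` and then smoothing. -/
def reverseSmoothArrow (j i : Fin n) (pj pi : ℚ) (b : GArrow n) : GArrow n :=
  smoothArrow j i pj (-pi) (reverseArrow i b)

theorem reverseSmoothArrow_injective {j i : Fin n} (hij : j ≠ i) (pj pi : ℚ) :
    Function.Injective (reverseSmoothArrow j i pj pi) :=
  (smoothArrow_injective hij pj (-pi)).comp (reverseArrow_injective i)

/-- The arrows of a planar tree containing the crossing arrow whose tail is on a string
below `i`: their endpoints survive on the trunk `j` of the smoothing of the reversed diagram. -/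
def IsLow (I : Finset (Fin n)) (j i : Fin n) (pj pi : ℚ) (b : GArrow n) : Prop :=
  (b.tailStr ∈ I ∧ b.tailStr < i) ∧
    ((b.headStr ∈ I ∧ b.headStr < i) ∨ (b.headStr = i ∧ b.headPos < pi) ∨
      (b.headStr = j ∧ b.headPos < pj))

/-- The arrows of a planar tree containing the crossing arrow whose tail is on a string
above `i`: their endpoints survive on the trunk `i` of the oriented smoothing. -/
def IsHigh (I : Finset (Fin n)) (j i : Fin n) (pj pi : ℚ) (b : GArrow n) : Prop :=
  (b.tailStr ∈ I ∧ i < b.tailStr) ∧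
    ((b.headStr ∈ I ∧ i < b.headStr) ∨ (b.headStr = i ∧ b.headPos < pi) ∨
      (b.headStr = j ∧ pj < b.headPos))

variable {I : Finset (Fin n)} {j i : Fin n} {pj pi : ℚ} {b : GArrow n}

theorem IsLow.reverseSmoothArrow_eq (hj : j ∉ I) (hji : j < i) (h : IsLow I j i pj pi b) :
    reverseSmoothArrow j i pj pi b =
      ⟨b.tailStr, b.tailPos, if b.headStr = i then j else b.headStr,
        if b.headStr = i then pj + (pi - b.headPos) else b.headPos,
        if b.headStr = i then -b.sign else b.sign⟩ := by
  obtain ⟨ts, tp, hs, hp, s⟩ := b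
  simp only [IsLow, reverseSmoothArrow, smoothArrow, reverseArrow, smoothEp, GArrow.mk.injEq] at h ⊢
  grind

theorem IsHigh.smoothArrow_eq (hji : j < i) (h : IsHigh I j i pj pi b) :
    smoothArrow j i pj pi b =
      ⟨b.tailStr, b.tailPos, if b.headStr = j then i else b.headStr,
        if b.headStr = j then pi + (b.headPos - pj) else b.headPos, b.sign⟩ := by
  obtain ⟨ts, tp, hs, hp, s⟩ := b
  simp only [IsHigh, smoothArrow, smoothEp, GArrow.mk.injEq] at h ⊢
  grind

theorem isLow_of_reverseSmoothArrow (hj : j ∉ I) (hji : j < i)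
    (hbj : b.headStr = j → b.headPos ≠ pj)
    (ht : (reverseSmoothArrow j i pj pi b).tailStr ∈ I.filter (· < i))
    (hh : (reverseSmoothArrow j i pj pi b).headStr ∈ I.filter (· < i) ∨
      (reverseSmoothArrow j i pj pi b).headStr = j) : IsLow I j i pj pi b := by
  obtain ⟨ts, tp, hs, hp, s⟩ := b
  simp only [IsLow, reverseSmoothArrow, smoothArrow, reverseArrow, smoothEp,
    Finset.mem_filter] at hbj ht hh ⊢
  grind

theorem isHigh_of_smoothArrow (hji : j < i)
    (hbi : b.headStr = i → b.headPos ≠ pi)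
    (ht : (smoothArrow j i pj pi b).tailStr ∈ I.filter (i < ·))
    (hh : (smoothArrow j i pj pi b).headStr ∈ I.filter (i < ·) ∨
      (smoothArrow j i pj pi b).headStr = i) : IsHigh I j i pj pi b := by
  obtain ⟨ts, tp, hs, hp, s⟩ := b
  simp only [IsHigh, smoothArrow, smoothEp, Finset.mem_filter] at hbi ht hh ⊢
  grind

end Smoothing

section Descent

variable {n : ℕ} {S T : Finset (GArrow n)} {J : Finset (Fin n)}

theorem Descends.mem (hJ : ∀ u v, ParentRel T u v → v ∈ J) {u k : Fin n} (hu : u ∈ J)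
    (h : Descends T u k) : k ∈ J := by
  induction h with
  | refl => exact hu
  | tail _ h _ => exact hJ _ _ h

theorem descends_congr (hJ : ∀ u v, ParentRel T u v → v ∈ J)
    (hST : ∀ u ∈ J, ∀ v, ParentRel T u v ↔ ParentRel S u v) {u k : Fin n} (hu : u ∈ J) :
    Descends T u k ↔ Descends S u k := by
  constructor
  · intro h
    induction h with
    | refl => exact .refl
    | tail h₁ h₂ ih => exact ih.tail ((hST _ (Descends.mem hJ hu h₁) _).1 h₂)
  · intro h
    induction h with
    | refl => exact .refl
    | tail _ h₂ ih => exact ih.tail ((hST _ (Descends.mem hJ hu ih) _).2 h₂)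

theorem transGen_of_transGen {r r' : Fin n} (hr : r ∉ J)
    (hJ : ∀ v ∈ J, ∀ u, ParentRel S u v →
      u ∈ J ∧ ParentRel T u v ∨ Relation.TransGen (ParentRel T) r' v)
    {v : Fin n} (hv : v ∈ J) (h : Relation.TransGen (ParentRel S) r v) :
    Relation.TransGen (ParentRel T) r' v := by
  induction h with
  | single h => exact (hJ _ hv _ h).elim (fun h' => absurd h'.1 hr) id
  | tail _ h₂ ih => exact (hJ _ hv _ h₂).elim (fun h' => (ih h'.1).tail h'.2) id

theorem parentRel_image {f : GArrow n → GArrow n} {u v : Fin n} :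
    ParentRel (S.image f) u v ↔ ∃ b ∈ S, (f b).tailStr = v ∧ (f b).headStr = u := by
  simp [ParentRel]

end Descent

section Splice

variable {n : ℕ} {I : Finset (Fin n)} {j i : Fin n} {pj pi : ℚ} {σ : ℤ}
  {S₁ S₂ : Finset (GArrow n)}

/-- The arrows of a tree diagram containing the crossing arrow, which points from string `i`
to string `j`. -/
noncomputable def spliced (j i : Fin n) (pj pi : ℚ) (σ : ℤ) (S₁ S₂ : Finset (GArrow n)) :
    Finset (GArrow n) :=
  insert ⟨i, pi, j, pj, σ⟩ (S₁ ∪ S₂)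

theorem parentRel_spliced {u v : Fin n} :
    ParentRel (spliced j i pj pi σ S₁ S₂) u v ↔
      (v = i ∧ u = j) ∨ (∃ b ∈ S₁, b.tailStr = v ∧ b.headStr = u) ∨
        ∃ b ∈ S₂, b.tailStr = v ∧ b.headStr = u := by
  simp only [ParentRel, spliced, Finset.mem_insert, Finset.mem_union]
  constructor
  · rintro ⟨b, rfl | hb | hb, rfl, rfl⟩
    · simp
    · exact .inr (.inl ⟨b, hb, rfl, rfl⟩)
    · exact .inr (.inr ⟨b, hb, rfl, rfl⟩)
  · rintro (⟨rfl, rfl⟩ | ⟨b, hb, rfl, rfl⟩ | ⟨b, hb, rfl, rfl⟩)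
    · exact ⟨_, .inl rfl, rfl, rfl⟩
    · exact ⟨b, .inr (.inl hb), rfl, rfl⟩
    · exact ⟨b, .inr (.inr hb), rfl, rfl⟩

theorem parentRel_low (hjI : ∀ x ∈ I, j < x) (hi : i ∈ I)
    (h₁ : ∀ b ∈ S₁, IsLow I j i pj pi b) {u v : Fin n} :
    ParentRel (S₁.image (reverseSmoothArrow j i pj pi)) u v ↔
      ∃ b ∈ S₁, b.tailStr = v ∧ (if b.headStr = i then j else b.headStr) = u := by
  have hj : j ∉ I := fun h => lt_irrefl _ (hjI j h)
  rw [parentRel_image]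
  refine exists_congr fun b => and_congr_right fun hb => ?_
  rw [(h₁ b hb).reverseSmoothArrow_eq hj (hjI i hi)]

theorem parentRel_high (hjI : ∀ x ∈ I, j < x) (hi : i ∈ I)
    (h₂ : ∀ b ∈ S₂, IsHigh I j i pj pi b) {u v : Fin n} :
    ParentRel (S₂.image (smoothArrow j i pj pi)) u v ↔
      ∃ b ∈ S₂, b.tailStr = v ∧ (if b.headStr = j then i else b.headStr) = u := by
  rw [parentRel_image]
  refine exists_congr fun b => and_congr_right fun hb => ?_
  rw [(h₂ b hb).smoothArrow_eq (hjI i hi)]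

theorem descends_low (hjI : ∀ x ∈ I, j < x) (hi : i ∈ I)
    (h₁ : ∀ b ∈ S₁, IsLow I j i pj pi b) (h₂ : ∀ b ∈ S₂, IsHigh I j i pj pi b)
    {u k : Fin n} (hu : u ∈ I.filter (· < i)) :
    (Descends (S₁.image (reverseSmoothArrow j i pj pi)) u k ↔
      Descends (spliced j i pj pi σ S₁ S₂) u k) := by
  refine descends_congr (J := I.filter (· < i)) ?_ ?_ hu
  · intro u v h
    obtain ⟨b, hb, rfl, -⟩ := (parentRel_low hjI hi h₁).1 h
    exact Finset.mem_filter.2 (h₁ b hb).1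
  · intro u hu v
    rw [parentRel_low hjI hi h₁, parentRel_spliced]
    rw [Finset.mem_filter] at hu
    have := hjI u hu.1
    constructor
    · rintro ⟨b, hb, rfl, h⟩
      exact .inr (.inl ⟨b, hb, rfl, by grind⟩)
    · rintro (⟨rfl, rfl⟩ | ⟨b, hb, rfl, rfl⟩ | ⟨b, hb, rfl, rfl⟩)
      · exact absurd this (lt_irrefl _)
      · exact ⟨b, hb, rfl, if_neg hu.2.ne⟩
      · have := h₂ b hb
        simp only [IsHigh] at this
        grind

theorem descends_high (hjI : ∀ x ∈ I, j < x) (hi : i ∈ I)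
    (h₁ : ∀ b ∈ S₁, IsLow I j i pj pi b) (h₂ : ∀ b ∈ S₂, IsHigh I j i pj pi b)
    {u k : Fin n} (hu : u ∈ I.filter (i < ·)) :
    (Descends (S₂.image (smoothArrow j i pj pi)) u k ↔
      Descends (spliced j i pj pi σ S₁ S₂) u k) := by
  refine descends_congr (J := I.filter (i < ·)) ?_ ?_ hu
  · intro u v h
    obtain ⟨b, hb, rfl, -⟩ := (parentRel_high hjI hi h₂).1 h
    exact Finset.mem_filter.2 (h₂ b hb).1
  · intro u hu v
    rw [parentRel_high hjI hi h₂, parentRel_spliced]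
    rw [Finset.mem_filter] at hu
    have := hjI u hu.1
    constructor
    · rintro ⟨b, hb, rfl, h⟩
      exact .inr (.inr ⟨b, hb, rfl, by grind⟩)
    · rintro (⟨rfl, rfl⟩ | ⟨b, hb, rfl, rfl⟩ | ⟨b, hb, rfl, rfl⟩)
      · exact absurd this (lt_irrefl _)
      · have := h₁ b hb
        simp only [IsLow] at this
        grind
      · exact ⟨b, hb, rfl, if_neg this.ne'⟩

theorem mem_of_descends_low (hjI : ∀ x ∈ I, j < x) (hi : i ∈ I)
    (h₁ : ∀ b ∈ S₁, IsLow I j i pj pi b) (h₂ : ∀ b ∈ S₂, IsHigh I j i pj pi b)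
    {u k : Fin n} (hu : u ∈ I ∧ u < i) (h : Descends (spliced j i pj pi σ S₁ S₂) u k) :
    k ∈ I ∧ k < i := by
  have hu' : u ∈ I.filter (· < i) := Finset.mem_filter.2 hu
  rw [← descends_low hjI hi h₁ h₂ hu'] at h
  refine Finset.mem_filter.1 (Descends.mem (J := I.filter (· < i)) ?_ hu' h)
  intro u v h
  obtain ⟨b, hb, rfl, -⟩ := (parentRel_low hjI hi h₁).1 h
  exact Finset.mem_filter.2 (h₁ b hb).1

theorem mem_of_descends_high (hjI : ∀ x ∈ I, j < x) (hi : i ∈ I)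
    (h₁ : ∀ b ∈ S₁, IsLow I j i pj pi b) (h₂ : ∀ b ∈ S₂, IsHigh I j i pj pi b)
    {u k : Fin n} (hu : u ∈ I ∧ i < u) (h : Descends (spliced j i pj pi σ S₁ S₂) u k) :
    k ∈ I ∧ i < k := by
  have hu' : u ∈ I.filter (i < ·) := Finset.mem_filter.2 hu
  rw [← descends_high hjI hi h₁ h₂ hu'] at h
  refine Finset.mem_filter.1 (Descends.mem (J := I.filter (i < ·)) ?_ hu' h)
  intro u v h
  obtain ⟨b, hb, rfl, -⟩ := (parentRel_high hjI hi h₂).1 h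
  exact Finset.mem_filter.2 (h₂ b hb).1

theorem IsPlanarTreeDiagram.low (hjI : ∀ x ∈ I, j < x) (hi : i ∈ I)
    (h₁ : ∀ b ∈ S₁, IsLow I j i pj pi b) (h₂ : ∀ b ∈ S₂, IsHigh I j i pj pi b)
    (h : IsPlanarTreeDiagram I j (spliced j i pj pi σ S₁ S₂)) :
    IsPlanarTreeDiagram (I.filter (· < i)) j (S₁.image (reverseSmoothArrow j i pj pi)) := by
  have hj : j ∉ I := fun h => lt_irrefl _ (hjI j h)
  have hji : j < i := hjI i hi
  have hS : ∀ b ∈ S₁, b ∈ spliced j i pj pi σ S₁ S₂ := fun b hb => by simp [spliced, hb]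
  have ha : (⟨i, pi, j, pj, σ⟩ : GArrow n) ∈ spliced j i pj pi σ S₁ S₂ := by simp [spliced]
  have hd : ∀ b ∈ S₁, ∀ k,
      Descends (S₁.image (reverseSmoothArrow j i pj pi)) b.tailStr k →
        Descends (spliced j i pj pi σ S₁ S₂) b.tailStr k ∧ k ∈ I ∧ k < i := fun b hb k hk => by
    rw [descends_low hjI hi h₁ h₂ (Finset.mem_filter.2 (h₁ b hb).1)] at hk
    exact ⟨hk, mem_of_descends_low hjI hi h₁ h₂ (h₁ b hb).1 hk⟩
  have hdi : ∀ b ∈ S₁, b.headStr = i → ∀ k,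
      Descends (spliced j i pj pi σ S₁ S₂) b.tailStr k →
        Descends (spliced j i pj pi σ S₁ S₂) i k := fun b hb hbi k hk =>
    .head ⟨b, hS b hb, rfl, hbi⟩ hk
  have e := fun b hb => (h₁ b hb).reverseSmoothArrow_eq hj hji
  obtain ⟨⟨t₁, t₂, t₃, t₄, t₅⟩, hr, hside, hord⟩ := h
  refine ⟨⟨?_, ?_, ?_, ?_, ?_⟩, ?_, ?_, ?_⟩
  · simp only [Finset.forall_mem_image]
    intro b hb
    have := t₁ b (hS b hb)
    have := hjI _ (h₁ b hb).1.1
    grind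
  · intro x hx
    rw [Finset.mem_filter] at hx
    obtain ⟨b, ⟨hb, rfl⟩, hu⟩ := t₂ x hx.1
    have hb₁ : b ∈ S₁ := by
      simp only [spliced, Finset.mem_insert, Finset.mem_union] at hb
      rcases hb with rfl | hb | hb
      · exact absurd hx.2 (lt_irrefl _)
      · exact hb
      · exact absurd hx.2 (h₂ b hb).1.2.not_gt
    refine ⟨_, ⟨Finset.mem_image_of_mem _ hb₁, by rw [e b hb₁]⟩, ?_⟩
    simp only [and_imp, Finset.forall_mem_image]
    intro c hc hcb
    rw [e c hc] at hcb
    rw [hu c ⟨hS c hc, hcb⟩]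
  · simp only [Finset.forall_mem_image]
    intro b hb
    rw [e b hb]
    exact Finset.mem_filter.2 (h₁ b hb).1
  · simp only [Finset.forall_mem_image]
    intro b hb
    rw [e b hb, Finset.mem_filter]
    have := (h₁ b hb).2
    grind
  · simp only [Finset.forall_mem_image]
    intro b hb c hc
    rw [e b hb, e c hc]
    have := t₅ b (hS b hb) c (hS c hc)
    have := (h₁ c hc).1
    grind
  · intro x hx
    refine transGen_of_transGen (S := spliced j i pj pi σ S₁ S₂) (J := I.filter (· < i))
      (by simp [hj]) ?_ hx (hr x (Finset.mem_filter.1 hx).1)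
    intro v hv u huv
    rw [Finset.mem_filter] at hv
    simp only [parentRel_low hjI hi h₁, Finset.mem_filter]
    rcases parentRel_spliced.1 huv with ⟨rfl, rfl⟩ | ⟨b, hb, rfl, rfl⟩ | ⟨b, hb, rfl, rfl⟩
    · exact absurd hv.2 (lt_irrefl _)
    · rcases (h₁ b hb).2 with hh | hh | hh
      · exact .inl ⟨hh, b, hb, rfl, if_neg hh.2.ne⟩
      · exact .inr (.single ((parentRel_low hjI hi h₁).2 ⟨b, hb, rfl, if_pos hh.1⟩))
      · exact .inr (.single ((parentRel_low hjI hi h₁).2 ⟨b, hb, rfl, by grind⟩))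
    · exact absurd hv.2 (h₂ b hb).1.2.not_gt
  · simp only [Finset.forall_mem_image]
    intro b hb k hk
    rw [e b hb] at hk ⊢
    obtain ⟨hk, hkI⟩ := hd b hb k hk
    have := hside b (hS b hb) k hk
    have := hjI k hkI.1
    have := hjI _ (h₁ b hb).1.1
    grind
  · simp only [Finset.forall_mem_image]
    intro b hb c hc hbc hlt k k' hk hk'
    rw [e b hb, e c hc] at *
    obtain ⟨hk, hkI⟩ := hd b hb k hk
    obtain ⟨hk', hkI'⟩ := hd c hc k' hk'
    have hb' := hjI _ (h₁ b hb).1.1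
    have hc' := hjI _ (h₁ c hc).1.1
    have hbL := h₁ b hb
    have hcL := h₁ c hc
    have o₁ := hord b (hS b hb) c (hS c hc)
    have o₂ := hord c (hS c hc) b (hS b hb)
    have o₃ := hord b (hS b hb) _ ha
    simp only [IsLow] at hbL hcL
    by_cases hbi : b.headStr = i <;> by_cases hci : c.headStr = i <;>
      simp only [hbi, hci, if_true, if_false] at hbc hlt ⊢
    · have := o₂ (hci.trans hbi.symm) (by linarith) k' k hk' hk
      grind
    · grind
    · have := o₃ hbc (by grind) k k' hk (hdi c hc hci k' hk')
      grind
    · exact o₁ hbc hlt k k' hk hk'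

theorem IsPlanarTreeDiagram.high (hjI : ∀ x ∈ I, j < x) (hi : i ∈ I)
    (h₁ : ∀ b ∈ S₁, IsLow I j i pj pi b) (h₂ : ∀ b ∈ S₂, IsHigh I j i pj pi b)
    (h : IsPlanarTreeDiagram I j (spliced j i pj pi σ S₁ S₂)) :
    IsPlanarTreeDiagram (I.filter (i < ·)) i (S₂.image (smoothArrow j i pj pi)) := by
  have hj : j ∉ I := fun h => lt_irrefl _ (hjI j h)
  have hji : j < i := hjI i hi
  have hS : ∀ b ∈ S₂, b ∈ spliced j i pj pi σ S₁ S₂ := fun b hb => by simp [spliced, hb]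
  have ha : (⟨i, pi, j, pj, σ⟩ : GArrow n) ∈ spliced j i pj pi σ S₁ S₂ := by simp [spliced]
  have hd : ∀ b ∈ S₂, ∀ k,
      Descends (S₂.image (smoothArrow j i pj pi)) b.tailStr k →
        Descends (spliced j i pj pi σ S₁ S₂) b.tailStr k ∧ k ∈ I ∧ i < k := fun b hb k hk => by
    rw [descends_high hjI hi h₁ h₂ (Finset.mem_filter.2 (h₂ b hb).1)] at hk
    exact ⟨hk, mem_of_descends_high hjI hi h₁ h₂ (h₂ b hb).1 hk⟩
  have hdi : ∀ b ∈ S₂, b.headStr = i → ∀ k,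
      Descends (spliced j i pj pi σ S₁ S₂) b.tailStr k →
        Descends (spliced j i pj pi σ S₁ S₂) i k := fun b hb hbi k hk =>
    .head ⟨b, hS b hb, rfl, hbi⟩ hk
  have e := fun b hb => (h₂ b hb).smoothArrow_eq hji
  obtain ⟨⟨t₁, t₂, t₃, t₄, t₅⟩, hr, hside, hord⟩ := h
  refine ⟨⟨?_, ?_, ?_, ?_, ?_⟩, ?_, ?_, ?_⟩
  · simp only [Finset.forall_mem_image]
    intro b hb
    have := t₁ b (hS b hb)
    have := (h₂ b hb).1.2
    grind
  · intro x hx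
    rw [Finset.mem_filter] at hx
    obtain ⟨b, ⟨hb, rfl⟩, hu⟩ := t₂ x hx.1
    have hb₁ : b ∈ S₂ := by
      simp only [spliced, Finset.mem_insert, Finset.mem_union] at hb
      rcases hb with rfl | hb | hb
      · exact absurd hx.2 (lt_irrefl _)
      · exact absurd hx.2 (h₁ b hb).1.2.not_gt
      · exact hb
    refine ⟨_, ⟨Finset.mem_image_of_mem _ hb₁, by rw [e b hb₁]⟩, ?_⟩
    simp only [and_imp, Finset.forall_mem_image]
    intro c hc hcb
    rw [e c hc] at hcb
    rw [hu c ⟨hS c hc, hcb⟩]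
  · simp only [Finset.forall_mem_image]
    intro b hb
    rw [e b hb]
    exact Finset.mem_filter.2 (h₂ b hb).1
  · simp only [Finset.forall_mem_image]
    intro b hb
    rw [e b hb, Finset.mem_filter]
    have := (h₂ b hb).2
    grind
  · simp only [Finset.forall_mem_image]
    intro b hb c hc
    rw [e b hb, e c hc]
    have := t₅ b (hS b hb) c (hS c hc)
    have := (h₂ c hc).1
    grind
  · intro x hx
    refine transGen_of_transGen (S := spliced j i pj pi σ S₁ S₂) (J := I.filter (i < ·))
      (by simp [hj]) ?_ hx (hr x (Finset.mem_filter.1 hx).1)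
    intro v hv u huv
    rw [Finset.mem_filter] at hv
    simp only [parentRel_high hjI hi h₂, Finset.mem_filter]
    rcases parentRel_spliced.1 huv with ⟨rfl, rfl⟩ | ⟨b, hb, rfl, rfl⟩ | ⟨b, hb, rfl, rfl⟩
    · exact absurd hv.2 (lt_irrefl _)
    · exact absurd hv.2 (h₁ b hb).1.2.not_gt
    · rcases (h₂ b hb).2 with hh | hh | hh
      · exact .inl ⟨hh, b, hb, rfl, if_neg (hjI _ hh.1).ne'⟩
      · exact .inr (.single ((parentRel_high hjI hi h₂).2 ⟨b, hb, rfl, by grind⟩))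
      · exact .inr (.single ((parentRel_high hjI hi h₂).2 ⟨b, hb, rfl, if_pos hh.1⟩))
  · simp only [Finset.forall_mem_image]
    intro b hb k hk
    rw [e b hb] at hk ⊢
    obtain ⟨hk, hkI⟩ := hd b hb k hk
    have := hside b (hS b hb) k hk
    have := (h₂ b hb).1.2
    grind
  · simp only [Finset.forall_mem_image]
    intro b hb c hc hbc hlt k k' hk hk'
    rw [e b hb, e c hc] at *
    obtain ⟨hk, hkI⟩ := hd b hb k hk
    obtain ⟨hk', hkI'⟩ := hd c hc k' hk'
    have hb' := hjI _ (h₂ b hb).1.1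
    have hc' := hjI _ (h₂ c hc).1.1
    have hbL := h₂ b hb
    have hcL := h₂ c hc
    have o₁ := hord b (hS b hb) c (hS c hc)
    have o₃ := hord _ ha c (hS c hc)
    simp only [IsHigh] at hbL hcL
    by_cases hbi : b.headStr = j <;> by_cases hci : c.headStr = j <;>
      simp only [hbi, hci, if_true, if_false] at hbc hlt ⊢
    · have := o₁ (hbi.trans hci.symm) (by linarith) k k' hk hk'
      grind
    · grind
    · have := o₃ hci.symm (by grind) k k' (hdi b hb hbc k hk) hk'
      grind
    · exact o₁ hbc hlt k k' hk hk'

set_option maxHeartbeats 1000000 in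
theorem IsPlanarTreeDiagram.splice (hjI : ∀ x ∈ I, j < x) (hi : i ∈ I)
    (h₁ : ∀ b ∈ S₁, IsLow I j i pj pi b) (h₂ : ∀ b ∈ S₂, IsHigh I j i pj pi b)
    (hL : IsPlanarTreeDiagram (I.filter (· < i)) j (S₁.image (reverseSmoothArrow j i pj pi)))
    (hH : IsPlanarTreeDiagram (I.filter (i < ·)) i (S₂.image (smoothArrow j i pj pi))) :
    IsPlanarTreeDiagram I j (spliced j i pj pi σ S₁ S₂) := by
  have hj : j ∉ I := fun h => lt_irrefl _ (hjI j h)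
  have hji : j < i := hjI i hi
  have e₁ := fun b hb => (h₁ b hb).reverseSmoothArrow_eq hj hji
  have e₂ := fun b hb => (h₂ b hb).smoothArrow_eq hji
  have hroot : ParentRel (spliced j i pj pi σ S₁ S₂) j i := parentRel_spliced.2 (.inl ⟨rfl, rfl⟩)
  have hd₁ : ∀ b ∈ S₁, ∀ k, Descends (spliced j i pj pi σ S₁ S₂) b.tailStr k →
      Descends (S₁.image (reverseSmoothArrow j i pj pi)) b.tailStr k ∧ k ∈ I ∧ k < i :=
    fun b hb k hk => ⟨(descends_low hjI hi h₁ h₂ (Finset.mem_filter.2 (h₁ b hb).1)).2 hk,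
      mem_of_descends_low hjI hi h₁ h₂ (h₁ b hb).1 hk⟩
  have hd₂ : ∀ b ∈ S₂, ∀ k, Descends (spliced j i pj pi σ S₁ S₂) b.tailStr k →
      Descends (S₂.image (smoothArrow j i pj pi)) b.tailStr k ∧ k ∈ I ∧ i < k :=
    fun b hb k hk => ⟨(descends_high hjI hi h₁ h₂ (Finset.mem_filter.2 (h₂ b hb).1)).2 hk,
      mem_of_descends_high hjI hi h₁ h₂ (h₂ b hb).1 hk⟩
  have hdi : ∀ k, Descends (spliced j i pj pi σ S₁ S₂) i k → k = i ∨
      (∃ b ∈ S₁, b.headStr = i ∧ Descends (spliced j i pj pi σ S₁ S₂) b.tailStr k) ∨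
      ∃ b ∈ S₂, b.headStr = i ∧ Descends (spliced j i pj pi σ S₁ S₂) b.tailStr k := by
    intro k hk
    rcases hk.cases_head with rfl | ⟨v, hv, hvk⟩
    · exact .inl rfl
    · rcases parentRel_spliced.1 hv with ⟨-, h⟩ | ⟨b, hb, rfl, hbi⟩ | ⟨b, hb, rfl, hbi⟩
      · exact absurd h hji.ne'
      · exact .inr (.inl ⟨b, hb, hbi, hvk⟩)
      · exact .inr (.inr ⟨b, hb, hbi, hvk⟩)
  obtain ⟨⟨s₁, s₂, s₃, s₄, s₅⟩, sr, sside, sord⟩ := hL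
  obtain ⟨⟨t₁, t₂, t₃, t₄, t₅⟩, tr, tside, tord⟩ := hH
  simp only [Finset.forall_mem_image] at s₁ s₅ sside sord t₁ t₅ tside tord
  have hforall : ∀ P : GArrow n → Prop, P ⟨i, pi, j, pj, σ⟩ → (∀ b ∈ S₁, P b) →
      (∀ b ∈ S₂, P b) → ∀ b ∈ spliced j i pj pi σ S₁ S₂, P b := by
    intro P hP hP₁ hP₂ b hb
    simp only [spliced, Finset.mem_insert, Finset.mem_union] at hb
    rcases hb with rfl | hb | hb
    exacts [hP, hP₁ b hb, hP₂ b hb]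
  refine ⟨⟨?_, ?_, ?_, ?_, ?_⟩, ?_, ?_, ?_⟩
  · refine hforall _ hji.ne' (fun b hb => ?_) (fun b hb => ?_)
    · have := h₁ b hb
      have := s₁ hb
      rw [e₁ b hb] at this
      simp only [IsLow] at *
      grind
    · have := h₂ b hb
      have := t₁ hb
      rw [e₂ b hb] at this
      simp only [IsHigh] at *
      grind
  · intro x hx
    rcases lt_trichotomy x i with hxi | rfl | hxi
    · obtain ⟨c, ⟨hc, rfl⟩, hu⟩ := s₂ x (Finset.mem_filter.2 ⟨hx, hxi⟩)
      obtain ⟨b, hb, rfl⟩ := Finset.mem_image.1 hc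
      rw [e₁ b hb] at hxi ⊢
      refine ⟨b, ⟨by simp [spliced, hb], rfl⟩, fun c hc => ?_⟩
      obtain ⟨hc, hcb⟩ := hc
      revert c
      refine hforall _ (fun h => absurd hxi h.not_gt.elim) (fun c hc hcb => ?_)
        (fun c hc hcb => ?_)
      · exact reverseSmoothArrow_injective hji.ne _ _
          (hu _ ⟨Finset.mem_image_of_mem _ hc, by rw [e₁ c hc, e₁ b hb]; exact hcb⟩)
      · exact absurd (h₂ c hc).1.2 (by simpa [hcb] using hxi.le)
    · refine ⟨_, ⟨Finset.mem_insert_self _ _, rfl⟩, fun c hc => ?_⟩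
      obtain ⟨hc, hcb⟩ := hc
      revert c
      exact hforall _ (fun _ => rfl) (fun c hc hcb => absurd hcb (h₁ c hc).1.2.ne)
        (fun c hc hcb => absurd hcb (h₂ c hc).1.2.ne')
    · obtain ⟨c, ⟨hc, rfl⟩, hu⟩ := t₂ x (Finset.mem_filter.2 ⟨hx, hxi⟩)
      obtain ⟨b, hb, rfl⟩ := Finset.mem_image.1 hc
      rw [e₂ b hb] at hxi ⊢
      refine ⟨b, ⟨by simp [spliced, hb], rfl⟩, fun c hc => ?_⟩
      obtain ⟨hc, hcb⟩ := hc
      revert c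
      refine hforall _ (fun h => absurd hxi h.not_lt.elim) (fun c hc hcb => ?_)
        (fun c hc hcb => ?_)
      · exact absurd (h₁ c hc).1.2 (by simpa [hcb] using hxi.le)
      · exact smoothArrow_injective hji.ne _ _
          (hu _ ⟨Finset.mem_image_of_mem _ hc, by rw [e₂ c hc, e₂ b hb]; exact hcb⟩)
  · exact hforall _ hi (fun b hb => (h₁ b hb).1.1) (fun b hb => (h₂ b hb).1.1)
  · refine hforall _ (.inr rfl) (fun b hb => ?_) (fun b hb => ?_)
    · have := h₁ b hb
      simp only [IsLow] at this
      grind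
    · have := h₂ b hb
      simp only [IsHigh] at this
      grind
  · refine hforall _ ?_ (fun b hb => ?_) (fun b hb => ?_) <;>
      refine hforall _ ?_ (fun c hc => ?_) (fun c hc => ?_)
    · exact fun h => absurd h hji.ne
    · exact fun h => absurd (hjI _ (h₁ c hc).1.1) h.not_lt
    · exact fun h => absurd (hjI _ (h₂ c hc).1.1) h.not_lt
    · have := (h₁ b hb).2
      grind
    · have h := s₅ hb hc
      rw [e₁ b hb, e₁ c hc] at h
      have := h₁ b hb
      have := h₁ c hc
      simp only [IsLow] at *
      grind
    · have := h₁ b hb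
      have := h₂ c hc
      simp only [IsLow, IsHigh] at *
      grind
    · have := (h₂ b hb).2
      grind
    · have := h₂ b hb
      have := h₁ c hc
      simp only [IsLow, IsHigh] at *
      grind
    · have h := t₅ hb hc
      rw [e₂ b hb, e₂ c hc] at h
      have := h₂ b hb
      have := h₂ c hc
      simp only [IsHigh] at *
      grind
  · intro x hx
    rcases lt_trichotomy x i with hxi | rfl | hxi
    · refine transGen_of_transGen (S := S₁.image (reverseSmoothArrow j i pj pi))
        (J := I.filter (· < i)) (by simp [hj]) ?_ (Finset.mem_filter.2 ⟨hx, hxi⟩)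
        (sr x (Finset.mem_filter.2 ⟨hx, hxi⟩))
      intro v hv u huv
      obtain ⟨b, hb, rfl, rfl⟩ := (parentRel_low hjI hi h₁).1 huv
      have hp : ParentRel (spliced j i pj pi σ S₁ S₂) b.headStr b.tailStr :=
        parentRel_spliced.2 (.inr (.inl ⟨b, hb, rfl, rfl⟩))
      rcases (h₁ b hb).2 with hh | hh | hh
      · rw [if_neg hh.2.ne]
        exact .inl ⟨Finset.mem_filter.2 hh, hp⟩
      · rw [hh.1] at hp
        exact .inr (.head hroot (.single hp))
      · rw [hh.1] at hp
        exact .inr (.single hp)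
    · exact .single hroot
    · refine transGen_of_transGen (S := S₂.image (smoothArrow j i pj pi))
        (J := I.filter (i < ·)) (r := i) (by simp) ?_ (Finset.mem_filter.2 ⟨hx, hxi⟩)
        (tr x (Finset.mem_filter.2 ⟨hx, hxi⟩))
      intro v hv u huv
      obtain ⟨b, hb, rfl, rfl⟩ := (parentRel_high hjI hi h₂).1 huv
      have hp : ParentRel (spliced j i pj pi σ S₁ S₂) b.headStr b.tailStr :=
        parentRel_spliced.2 (.inr (.inr ⟨b, hb, rfl, rfl⟩))
      rcases (h₂ b hb).2 with hh | hh | hh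
      · rw [if_neg (hjI _ hh.1).ne']
        exact .inl ⟨Finset.mem_filter.2 hh, hp⟩
      · rw [hh.1] at hp
        exact .inr (.head hroot (.single hp))
      · rw [hh.1] at hp
        exact .inr (.single hp)
  · refine hforall _ (fun k hk => ?_) (fun b hb k hk => ?_) (fun b hb k hk => ?_)
    · have : j < k := by
        rcases hdi k hk with rfl | ⟨b, hb, -, hk⟩ | ⟨b, hb, -, hk⟩
        exacts [hji, hjI k (hd₁ b hb k hk).2.1, hjI k (hd₂ b hb k hk).2.1]
      exact iff_of_false hji.not_gt this.not_gt
    · have h := sside hb k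
      rw [e₁ b hb] at h
      have hk' := hd₁ b hb k hk
      have := h hk'.1
      have := hjI k hk'.2.1
      have hb' := h₁ b hb
      have := hjI _ hb'.1.1
      simp only [IsLow] at hb'
      grind
    · have h := tside hb k
      rw [e₂ b hb] at h
      have hk' := hd₂ b hb k hk
      have := h hk'.1
      have := hjI k hk'.2.1
      have hb' := h₂ b hb
      have := hjI _ hb'.1.1
      simp only [IsHigh] at hb'
      grind
  · refine hforall _ ?_ (fun b hb => ?_) (fun b hb => ?_) <;>
      refine hforall _ ?_ (fun c hc => ?_) (fun c hc => ?_) <;>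
      intro hbc hlt k k' hk hk'
    · exact absurd hlt (lt_irrefl _)
    · have := (h₁ c hc).2
      grind
    · have hck := hd₂ c hc k' hk'
      refine ⟨fun h => absurd h hji.not_gt, fun _ _ => ?_⟩
      rcases hdi k hk with rfl | ⟨b, hb, hbi, hk⟩ | ⟨b, hb, hbi, hk⟩
      · exact hck.2.2
      · exact (hd₁ b hb k hk).2.2.trans hck.2.2
      · have h := tord hb hc
        rw [e₂ b hb, e₂ c hc] at h
        have hb' := h₂ b hb
        have hc' := h₂ c hc
        have := fun p q => h p q k k' (hd₂ b hb k hk).1 hck.1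
        simp only [IsHigh] at hb' hc'
        simp only [hbi, if_neg hji.ne', ← hbc, if_true] at this
        exact (this trivial (by linarith [hb'.2, show b.headPos < pi by grind])).2 hb'.1.2 hc'.1.2
    · have hbk := hd₁ b hb k hk
      refine ⟨fun h => ?_, fun _ _ => ?_⟩
      · exact absurd (hjI _ (h₁ b hb).1.1) (by simpa [hbc] using h.le)
      rcases hdi k' hk' with rfl | ⟨c, hc, hci, hk'⟩ | ⟨c, hc, hci, hk'⟩
      · exact hbk.2.2
      · have h := sord hb hc
        rw [e₁ b hb, e₁ c hc] at h
        have hb' := h₁ b hb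
        have hc' := h₁ c hc
        have := fun p q => h p q k k' hbk.1 (hd₁ c hc k' hk').1
        simp only [IsLow] at hb' hc'
        simp only [hci, hbc, if_neg hji.ne, if_true] at this
        exact (this trivial (by linarith [show c.headPos < pi by grind])).2 (hjI _ hb'.1.1)
          (hjI _ hc'.1.1)
      · exact hbk.2.2.trans (hd₂ c hc k' hk').2.2
    · have h₃ := sord hb hc
      have h₄ := sord hc hb
      rw [e₁ b hb, e₁ c hc] at h₃ h₄
      have hbk := hd₁ b hb k hk
      have hck := hd₁ c hc k' hk'
      have hb' := h₁ b hb
      have hc' := h₁ c hc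
      have := hjI _ hb'.1.1
      have := hjI _ hc'.1.1
      simp only [IsLow] at hb' hc'
      by_cases hci : c.headStr = i
      · have := h₄ (by simp [hbc, hci]) (by simp [hbc, hci]; exact hlt) k' k hck.1 hbk.1
        grind
      · have := h₃ (by simp [hbc]) (by simp [hbc, hci]; exact hlt) k k' hbk.1 hck.1
        grind
    · have hbk := hd₁ b hb k hk
      have hck := hd₂ c hc k' hk'
      have hb' := h₁ b hb
      have hc' := h₂ c hc
      have := hjI _ hb'.1.1
      have := hjI _ hc'.1.1
      simp only [IsLow, IsHigh] at hb' hc'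
      grind
    · have := (h₂ b hb).2
      grind
    · have hb' := h₂ b hb
      have hc' := h₁ c hc
      have := hjI _ hb'.1.1
      have := hjI _ hc'.1.1
      simp only [IsLow, IsHigh] at hb' hc'
      grind
    · have h₃ := tord hb hc
      rw [e₂ b hb, e₂ c hc] at h₃
      have hbk := hd₂ b hb k hk
      have hck := hd₂ c hc k' hk'
      have hb' := h₂ b hb
      have hc' := h₂ c hc
      have := hjI _ hb'.1.1
      have := hjI _ hc'.1.1
      simp only [IsHigh] at hb' hc'
      have := h₃ (by simp [hbc]) (by simp only [hbc]; split_ifs <;> linarith) k k' hbk.1 hck.1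
      grind

/-- The arrows, other than the crossing arrow, of a planar tree diagram containing it. -/
theorem IsPlanarTreeDiagram.isLow_or_isHigh (hjI : ∀ x ∈ I, j < x) (hi : i ∈ I)
    {S : Finset (GArrow n)} (ha : (⟨i, pi, j, pj, σ⟩ : GArrow n) ∉ S)
    (hpj : ∀ b ∈ S, b.headStr = j → b.headPos ≠ pj)
    (h : IsPlanarTreeDiagram I j (insert ⟨i, pi, j, pj, σ⟩ S)) {b : GArrow n} (hb : b ∈ S) :
    IsLow I j i pj pi b ∨ IsHigh I j i pj pi b := by
  have hj : j ∉ I := fun h => lt_irrefl _ (hjI j h)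
  have hji : j < i := hjI i hi
  obtain ⟨⟨t₁, t₂, t₃, t₄, t₅⟩, hr, hside, hord⟩ := h
  simp only [Finset.forall_mem_insert] at t₃ t₄
  have ha' := Finset.mem_insert_self (⟨i, pi, j, pj, σ⟩ : GArrow n) S
  have hS : ∀ b ∈ S, b ∈ insert (⟨i, pi, j, pj, σ⟩ : GArrow n) S :=
    fun b hb => Finset.mem_insert_of_mem hb
  have hne : ∀ b ∈ S, b.tailStr ≠ i := by
    intro b hb hbi
    obtain ⟨c, -, hc⟩ := t₂ i hi
    exact ha (hc _ ⟨ha', rfl⟩ ▸ hc _ ⟨hS b hb, hbi⟩ ▸ hb)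
  have hself : ∀ s, Descends (insert (⟨i, pi, j, pj, σ⟩ : GArrow n) S) s s := fun s => .refl
  have hbi := hne b hb
  have htI := t₃.2 b hb
  have hhead : b.headStr ∈ I → b.headStr ≠ i → (b.headStr < i ↔ b.tailStr < i) := by
    intro hhI hhi
    have hpar : ParentRel (insert (⟨i, pi, j, pj, σ⟩ : GArrow n) S) b.headStr b.tailStr :=
      ⟨b, hS b hb, rfl, rfl⟩
    obtain ⟨v, ⟨c, hc, rfl, hcj⟩, hv⟩ := Relation.TransGen.head'_iff.1 (hr _ hhI)
    rcases Finset.mem_insert.1 hc with rfl | hcS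
    · rcases hv.cases_head with h | ⟨w, ⟨d, hd, rfl, hdi⟩, hw⟩
      · exact absurd h.symm hhi
      · have h₃ := hside d hd _ hw
        have h₄ := hside d hd _ (hw.tail hpar)
        rw [hdi] at h₃ h₄
        exact h₃.symm.trans h₄
    · have hjc := hjI _ (t₃.2 c hcS)
      rcases lt_or_gt_of_ne (hpj c hcS hcj) with hlt | hlt
      · have h := fun k hk => (hord c hc _ ha' hcj hlt k i hk (hself i)).2 (hcj ▸ hjc) hji
        exact iff_of_true (h _ hv) (h _ (hv.tail hpar))
      · have h := fun k hk =>
          (hord _ ha' c hc hcj.symm hlt i k (hself i) hk).2 hji (hcj ▸ hjc)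
        exact iff_of_false (h _ hv).not_gt (h _ (hv.tail hpar)).not_gt
  have htail : b.headStr = i → b.headPos < pi := fun h => t₅ b (hS b hb) _ ha' h
  have hbj : b.headStr = j → (b.headPos < pj ∧ b.tailStr < i ∨ pj < b.headPos ∧ i < b.tailStr) := by
    intro h
    have hjb := hjI _ htI
    rcases lt_or_gt_of_ne (hpj b hb h) with hlt | hlt
    · exact .inl ⟨hlt, (hord b (hS b hb) _ ha' h hlt _ i (hself _) (hself i)).2 (h ▸ hjb) hji⟩
    · exact .inr ⟨hlt, (hord _ ha' b (hS b hb) h.symm hlt i _ (hself i) (hself _)).2 hji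
        (h ▸ hjb)⟩
  have := t₄.2 b hb
  simp only [IsLow, IsHigh]
  grind

theorem treeSign_mul_prod (S : Finset (GArrow n)) :
    treeSign S * ∏ b ∈ S, b.sign = ∏ b ∈ S, (if b.tailStr < b.headStr then -1 else 1) * b.sign := by
  rw [Finset.prod_mul_distrib, treeSign, Finset.prod_ite]
  simp

theorem treeSign_mul_prod_low (hjI : ∀ x ∈ I, j < x) (hi : i ∈ I)
    (h₁ : ∀ b ∈ S₁, IsLow I j i pj pi b) :
    treeSign (S₁.image (reverseSmoothArrow j i pj pi)) *
        ∏ b ∈ S₁.image (reverseSmoothArrow j i pj pi), b.sign =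
      treeSign S₁ * ∏ b ∈ S₁, b.sign := by
  have hj : j ∉ I := fun h => lt_irrefl _ (hjI j h)
  rw [treeSign_mul_prod, treeSign_mul_prod,
    Finset.prod_image (reverseSmoothArrow_injective (hjI i hi).ne _ _).injOn]
  refine Finset.prod_congr rfl fun b hb => ?_
  have hb' := (h₁ b hb).1
  have := hjI _ hb'.1
  rw [(h₁ b hb).reverseSmoothArrow_eq hj (hjI i hi)]
  grind

theorem treeSign_mul_prod_high (hjI : ∀ x ∈ I, j < x) (hi : i ∈ I)
    (h₂ : ∀ b ∈ S₂, IsHigh I j i pj pi b) :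
    treeSign (S₂.image (smoothArrow j i pj pi)) *
        ∏ b ∈ S₂.image (smoothArrow j i pj pi), b.sign =
      treeSign S₂ * ∏ b ∈ S₂, b.sign := by
  rw [treeSign_mul_prod, treeSign_mul_prod,
    Finset.prod_image (smoothArrow_injective (hjI i hi).ne _ _).injOn]
  refine Finset.prod_congr rfl fun b hb => ?_
  have hb' := (h₂ b hb).1
  have := hjI _ hb'.1
  rw [(h₂ b hb).smoothArrow_eq (hjI i hi)]
  grind

theorem sum_powerset_image {f : GArrow n → GArrow n} (hf : Function.Injective f)
    (E : Finset (GArrow n)) (F : Finset (GArrow n) → ℤ) :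
    ∑ T ∈ (E.image f).powerset, F T = ∑ S ∈ E.powerset, F (S.image f) := by
  rw [Finset.powerset_image, Finset.sum_image (Finset.image_injective hf).injOn]

theorem sum_spliced_eq_mul (hjI : ∀ x ∈ I, j < x) (hi : i ∈ I) {E : Finset (GArrow n)}
    (ha : (⟨i, pi, j, pj, σ⟩ : GArrow n) ∉ E)
    (hpj : ∀ b ∈ E, b.headStr = j → b.headPos ≠ pj)
    (hpi : ∀ b ∈ E, b.headStr = i → b.headPos ≠ pi) :
    (∑ S ∈ E.powerset, if IsPlanarTreeDiagram I j (insert ⟨i, pi, j, pj, σ⟩ S) then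
        treeSign S * ∏ b ∈ S, b.sign else 0) =
      (∑ T ∈ (E.image (reverseSmoothArrow j i pj pi)).powerset,
        if IsPlanarTreeDiagram (I.filter (· < i)) j T then
          treeSign T * ∏ b ∈ T, b.sign else 0) *
      ∑ T ∈ (E.image (smoothArrow j i pj pi)).powerset,
        if IsPlanarTreeDiagram (I.filter (i < ·)) i T then
          treeSign T * ∏ b ∈ T, b.sign else 0 := by
  have hj : j ∉ I := fun h => lt_irrefl _ (hjI j h)
  have hji : j < i := hjI i hi
  rw [sum_powerset_image (reverseSmoothArrow_injective hji.ne _ _),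
    sum_powerset_image (smoothArrow_injective hji.ne _ _),
    ← Finset.sum_filter, ← Finset.sum_filter, ← Finset.sum_filter, Finset.sum_mul_sum,
    ← Finset.sum_product']
  have hsplit : ∀ S ∈ E.powerset.filter fun S =>
      IsPlanarTreeDiagram I j (insert ⟨i, pi, j, pj, σ⟩ S),
      (∀ b ∈ S.filter (·.tailStr < i), IsLow I j i pj pi b) ∧
      (∀ b ∈ S.filter (i < ·.tailStr), IsHigh I j i pj pi b) ∧
      S.filter (·.tailStr < i) ∪ S.filter (i < ·.tailStr) = S := by
    intro S hS
    rw [Finset.mem_filter, Finset.mem_powerset] at hS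
    have hlh := fun b (hb : b ∈ S) => hS.2.isLow_or_isHigh hjI hi (fun h => ha (hS.1 h))
      (fun b hb => hpj b (hS.1 hb)) hb
    refine ⟨fun b hb => ?_, fun b hb => ?_, ?_⟩
    · rw [Finset.mem_filter] at hb
      exact (hlh b hb.1).resolve_right fun h => h.1.2.not_gt hb.2
    · rw [Finset.mem_filter] at hb
      exact (hlh b hb.1).resolve_left fun h => h.1.2.not_gt hb.2
    · rw [← Finset.filter_or, Finset.filter_eq_self]
      exact fun b hb => (hlh b hb).imp (fun h => h.1.2) fun h => h.1.2
  have hlow : ∀ S ∈ E.powerset.filter fun S =>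
      IsPlanarTreeDiagram (I.filter (· < i)) j (S.image (reverseSmoothArrow j i pj pi)),
      ∀ b ∈ S, IsLow I j i pj pi b := by
    intro S hS b hb
    rw [Finset.mem_filter, Finset.mem_powerset] at hS
    exact isLow_of_reverseSmoothArrow hj hji (hpj b (hS.1 hb))
      (hS.2.1.2.2.1 _ (Finset.mem_image_of_mem _ hb))
      (hS.2.1.2.2.2.1 _ (Finset.mem_image_of_mem _ hb))
  have hhigh : ∀ S ∈ E.powerset.filter fun S =>
      IsPlanarTreeDiagram (I.filter (i < ·)) i (S.image (smoothArrow j i pj pi)),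
      ∀ b ∈ S, IsHigh I j i pj pi b := by
    intro S hS b hb
    rw [Finset.mem_filter, Finset.mem_powerset] at hS
    exact isHigh_of_smoothArrow hji (hpi b (hS.1 hb))
      (hS.2.1.2.2.1 _ (Finset.mem_image_of_mem _ hb))
      (hS.2.1.2.2.2.1 _ (Finset.mem_image_of_mem _ hb))
  refine Finset.sum_nbij' (fun S => (S.filter (·.tailStr < i), S.filter (i < ·.tailStr)))
    (fun p => p.1 ∪ p.2) ?_ ?_ ?_ ?_ ?_
  · intro S hS
    obtain ⟨h₁, h₂, hu⟩ := hsplit S hS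
    rw [Finset.mem_filter, Finset.mem_powerset] at hS
    have h := hS.2
    rw [← hu] at h
    simp only [Finset.mem_product, Finset.mem_filter, Finset.mem_powerset]
    exact ⟨⟨(Finset.filter_subset _ _).trans hS.1, h.low hjI hi h₁ h₂⟩,
      (Finset.filter_subset _ _).trans hS.1, h.high hjI hi h₁ h₂⟩
  · rintro ⟨S₁, S₂⟩ hp
    obtain ⟨hp₁, hp₂⟩ := Finset.mem_product.1 hp
    have h₁ := hlow _ hp₁
    have h₂ := hhigh _ hp₂
    simp only [Finset.mem_filter, Finset.mem_powerset] at hp₁ hp₂ ⊢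
    exact ⟨Finset.union_subset hp₁.1 hp₂.1, hp₁.2.splice hjI hi h₁ h₂ hp₂.2⟩
  · exact fun S hS => (hsplit S hS).2.2
  · rintro ⟨S₁, S₂⟩ hp
    obtain ⟨hp₁, hp₂⟩ := Finset.mem_product.1 hp
    have h₁ := fun b hb => (hlow _ hp₁ b hb).1.2
    have h₂ := fun b hb => (hhigh _ hp₂ b hb).1.2
    simp only [Prod.mk.injEq]
    constructor
    · ext b
      simp only [Finset.mem_filter, Finset.mem_union]
      exact ⟨fun h => h.1.resolve_right fun hb => (h₂ b hb).not_gt h.2,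
        fun hb => ⟨.inl hb, h₁ b hb⟩⟩
    · ext b
      simp only [Finset.mem_filter, Finset.mem_union]
      exact ⟨fun h => h.1.resolve_left fun hb => (h₁ b hb).not_gt h.2,
        fun hb => ⟨.inr hb, h₂ b hb⟩⟩
  · intro S hS
    obtain ⟨h₁, h₂, hu⟩ := hsplit S hS
    rw [treeSign_mul_prod_low hjI hi h₁, treeSign_mul_prod_high hjI hi h₂, treeSign_mul_prod,
      treeSign_mul_prod, treeSign_mul_prod]
    conv_lhs => rw [← hu]
    refine Finset.prod_union (Finset.disjoint_left.2 fun b hb hb' => ?_)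
    exact ((Finset.mem_filter.1 hb).2.trans (Finset.mem_filter.1 hb').2).false

theorem treeSign_mul_prod_insert {S : Finset (GArrow n)} {a : GArrow n} (haS : a ∉ S)
    (ha : a.headStr < a.tailStr) :
    treeSign (insert a S) * ∏ b ∈ insert a S, b.sign =
      a.sign * (treeSign S * ∏ b ∈ S, b.sign) := by
  rw [treeSign_mul_prod, treeSign_mul_prod, Finset.prod_insert haS, if_neg ha.not_gt, one_mul]

theorem not_isPlanarTreeDiagram_insert {S : Finset (GArrow n)} {a : GArrow n}
    (ha : a.tailStr ∉ I) : ¬ IsPlanarTreeDiagram I j (insert a S) :=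
  fun h => ha (h.1.2.2.1 a (Finset.mem_insert_self _ _))

theorem Z_eq_sum_add_sum_insert {G : GaussDiagram n} {E : Finset (GArrow n)} {a : GArrow n}
    (hG : G.arrows = insert a E) (ha : a ∉ E) :
    Z I j G = (∑ S ∈ E.powerset,
        if IsPlanarTreeDiagram I j S then treeSign S * ∏ b ∈ S, b.sign else 0) +
      ∑ S ∈ E.powerset, if IsPlanarTreeDiagram I j (insert a S) then
        treeSign (insert a S) * ∏ b ∈ insert a S, b.sign else 0 := by
  rw [Z, hG, Finset.sum_powerset_insert ha]

theorem sum_insert_eq_zero {E : Finset (GArrow n)} {a : GArrow n} (ha : a.tailStr ∉ I) :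
    (∑ S ∈ E.powerset, if IsPlanarTreeDiagram I j (insert a S) then
      treeSign (insert a S) * ∏ b ∈ insert a S, b.sign else 0) = 0 :=
  Finset.sum_eq_zero fun _ _ => if_neg (not_isPlanarTreeDiagram_insert ha)

theorem sum_insert_eq_sign_mul {E : Finset (GArrow n)} {a : GArrow n} (ha : a ∉ E)
    (hlt : a.headStr < a.tailStr) :
    (∑ S ∈ E.powerset, if IsPlanarTreeDiagram I j (insert a S) then
      treeSign (insert a S) * ∏ b ∈ insert a S, b.sign else 0) =
    a.sign * ∑ S ∈ E.powerset, if IsPlanarTreeDiagram I j (insert a S) then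
      treeSign S * ∏ b ∈ S, b.sign else 0 := by
  rw [Finset.mul_sum]
  refine Finset.sum_congr rfl fun S hS => ?_
  rw [treeSign_mul_prod_insert (fun h => ha (Finset.mem_powerset.1 hS h)) hlt, mul_ite, mul_zero]

end Splice

/-- **Skein relation, product form.**  Let `j < i₁ < … < i_r`,
`I = {i₁,…,i_r}`, `i = i_k ∈ I`, and let `(Gp, Gm, G0, Ginf)` be a skein
quadruple of Gauss diagrams on `n` strings at a crossing between strings `j`
and `i`.  Then
`Z_{I,j}(G₊) − Z_{I,j}(G₋) = Z_{I_k⁻, j}(G_∞) · Z_{I_k⁺, i_k}(G₀)`,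
where `I_k⁻ = {x ∈ I : x < i}` and `I_k⁺ = {x ∈ I : x > i}`. -/
theorem skein_product_form {n : ℕ} (I : Finset (Fin n)) (j : Fin n)
    (hjI : ∀ x ∈ I, j < x) (i : Fin n) (hi : i ∈ I)
    (Gp Gm G0 Ginf : GaussDiagram n)
    (hsk : IsSkeinQuadruple j i Gp Gm G0 Ginf) :
    Z I j Gp - Z I j Gm
      = Z (I.filter (· < i)) j Ginf * Z (I.filter (i < ·)) i G0 := by
  have hji : j < i := hjI i hi
  have hj : j ∉ I := fun h => lt_irrefl _ (hjI j h)
  obtain ⟨-, a, haG, hsign, hends, hGm, hG0, hGinf⟩ := hsk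
  have haE : a ∉ Gp.arrows.erase a := Finset.notMem_erase _ _
  have hdist : ∀ b ∈ Gp.arrows.erase a, ∀ s t, b.ep s ≠ a.ep t := fun b hb s t h =>
    (Finset.mem_erase.1 hb).1
      (Gp.endpoints_distinct b (Finset.mem_erase.1 hb).2 a haG s t h).1
  have hflip : GArrow.mk a.headStr a.headPos a.tailStr a.tailPos (-1) ∉ Gp.arrows.erase a :=
    fun h => hdist _ h false true rfl
  have hZinf : Ginf.arrows =
      (Gp.arrows.erase a).image (reverseSmoothArrow j i (posOn a j) (posOn a i)) := by
    rw [hGinf, ← Finset.image_erase (reverseArrow_injective i), Finset.image_image]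
    rfl
  have hpj : ∀ b ∈ Gp.arrows.erase a, b.headStr = j → b.headPos ≠ posOn a j := by
    intro b hb hbj hpos
    rcases hends with ⟨ht, hh⟩ | ⟨ht, hh⟩
    · exact hdist b hb true false (by simp [GArrow.ep, hbj, hpos, posOn, ht])
    · exact hdist b hb true true (by simp [GArrow.ep, hbj, hpos, posOn, ht, hh, hji.ne'])
  have hpi : ∀ b ∈ Gp.arrows.erase a, b.headStr = i → b.headPos ≠ posOn a i := by
    intro b hb hbi hpos
    rcases hends with ⟨ht, hh⟩ | ⟨ht, hh⟩
    · exact hdist b hb true true (by simp [GArrow.ep, hbi, hpos, posOn, ht, hh, hji.ne])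
    · exact hdist b hb true false (by simp [GArrow.ep, hbi, hpos, posOn, ht])
  rw [Z_eq_sum_add_sum_insert (Finset.insert_erase haG).symm haE,
    Z_eq_sum_add_sum_insert hGm hflip, add_sub_add_left_eq_sub, Z, Z, hZinf, hG0]
  rcases hends with ⟨ht, hh⟩ | ⟨ht, hh⟩
  · have hform : GArrow.mk a.headStr a.headPos a.tailStr a.tailPos (-1) =
        ⟨i, posOn a i, j, posOn a j, -1⟩ := by
      simp [posOn, ht, hh, hji.ne]
    rw [sum_insert_eq_zero (ht ▸ hj), sum_insert_eq_sign_mul hflip (by simpa [ht, hh] using hji),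
      hform, sum_spliced_eq_mul hjI hi (hform ▸ hflip) hpj hpi]
    ring
  · have hform : a = ⟨i, posOn a i, j, posOn a j, 1⟩ := by
      obtain ⟨ts, tp, hs, hp, s⟩ := a
      simp_all [posOn, hji.ne']
    have key := sum_spliced_eq_mul (σ := 1) hjI hi (by rwa [← hform]) hpj hpi
    rw [← hform] at key
    rw [sum_insert_eq_zero (a := GArrow.mk a.headStr a.headPos a.tailStr a.tailPos (-1))
        (by simpa [hh] using hj), sum_insert_eq_sign_mul haE (by simpa [ht, hh] using hji), key,
      hsign]
    ring
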